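/- Let Λ = U³ ⊕ E8² ⊕ ⟨−2⟩ and let ι ∈ O(Λ) be an involution whose invariant sublattice Λ^ι is isometric to U(2). Then the orthogonal complement (Λ^ι)^⊥ in Λ is isometric to U ⊕ U(2) ⊕ E8² ⊕ ⟨−2⟩. -/

import Mathlib

open Matrix

/-- The Gram pairing `(x, y) ↦ xᵀ G y` of an integer matrix `G`, as a bilinear map. -/
def gramBilin {n : ℕ} (G : Matrix (Fin n) (Fin n) ℤ) :
    (Fin n → ℤ) →ₗ[ℤ] (Fin n → ℤ) →ₗ[ℤ] ℤ :=
  Matrix.toLinearMap₂' ℤ G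

/-- The hyperbolic plane `U`, with Gram matrix `[[0,1],[1,0]]`. -/
def UGram : Matrix (Fin 2) (Fin 2) ℤ := !![0, 1; 1, 0]

/-- `U(2)`, with Gram matrix `[[0,2],[2,0]]`. -/
def U2Gram : Matrix (Fin 2) (Fin 2) ℤ := !![0, 2; 2, 0]

/-- `⟨2⟩ ⊕ ⟨-2⟩`. -/
def diag2Gram : Matrix (Fin 2) (Fin 2) ℤ := !![2, 0; 0, -2]

/-- The (negative definite even unimodular) `E8` lattice: the negative of the E₈ Cartan matrix. -/
def E8Gram : Matrix (Fin 8) (Fin 8) ℤ := -CartanMatrix.E₈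

/-- The rank-one lattice `⟨k⟩`. -/
def rankOneGram (k : ℤ) : Matrix (Fin 1) (Fin 1) ℤ := !![k]

/-- Orthogonal direct sum of two bilinear forms, on the product module. -/
def prodBilin {M N : Type*} [AddCommGroup M] [AddCommGroup N] [Module ℤ M] [Module ℤ N]
    (BM : M →ₗ[ℤ] M →ₗ[ℤ] ℤ) (BN : N →ₗ[ℤ] N →ₗ[ℤ] ℤ) :
    (M × N) →ₗ[ℤ] (M × N) →ₗ[ℤ] ℤ :=
  LinearMap.mk₂ ℤ (fun x y => BM x.1 y.1 + BN x.2 y.2)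
    (by intro m₁ m₂ n; simp [map_add]; ring)
    (by intro c m n; simp [_root_.map_smul, smul_eq_mul]; ring)
    (by intro m n₁ n₂; simp [map_add]; ring)
    (by intro c m n; simp [_root_.map_smul, smul_eq_mul]; ring)

/-- The underlying module of `Λ = U³ ⊕ E8² ⊕ ⟨-2⟩`. -/
abbrev LambdaM : Type :=
  (Fin 2 → ℤ) × (Fin 2 → ℤ) × (Fin 2 → ℤ) × (Fin 8 → ℤ) × (Fin 8 → ℤ) × (Fin 1 → ℤ)

/-- The bilinear form of the Beauville–Bogomolov lattice `Λ = U³ ⊕ E8² ⊕ ⟨-2⟩`. -/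
def LambdaB : LambdaM →ₗ[ℤ] LambdaM →ₗ[ℤ] ℤ :=
  prodBilin (gramBilin UGram) <| prodBilin (gramBilin UGram) <| prodBilin (gramBilin UGram) <|
    prodBilin (gramBilin E8Gram) <| prodBilin (gramBilin E8Gram) (gramBilin (rankOneGram (-2)))

/-- Membership in `O(Λ)`: a linear automorphism preserving the form. -/
def IsIsometry (f : LambdaM ≃ₗ[ℤ] LambdaM) : Prop :=
  ∀ x y, LambdaB (f x) (f y) = LambdaB x y

/-- The invariant sublattice `Λ^ι = {x | ι x = x}`. -/
def invLattice (f : LambdaM ≃ₗ[ℤ] LambdaM) : Submodule ℤ LambdaM :=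
  LinearMap.eqLocus (f : LambdaM →ₗ[ℤ] LambdaM) (LinearMap.id)

/-- A submodule of `Λ`, with the restricted form, is isometric to the lattice `(N, BN)`. -/
def IsometricTo {N : Type*} [AddCommGroup N] [Module ℤ N]
    (K : Submodule ℤ LambdaM) (BN : N →ₗ[ℤ] N →ₗ[ℤ] ℤ) : Prop :=
  ∃ e : K ≃ₗ[ℤ] N, ∀ x y : K, BN (e x) (e y) = LambdaB (x : LambdaM) (y : LambdaM)

/-- `div_Λ(v) = d`: the ideal of values `B(v, ·)` is generated by the positive integer `d`. -/
def HasDivisibility (v : LambdaM) (d : ℤ) : Prop :=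
  0 < d ∧ (∀ x, d ∣ LambdaB v x) ∧ ∃ x, LambdaB v x = d

/-- Conjugacy in `O(Λ)`: `ι' = γ ∘ ι ∘ γ⁻¹` for some isometry `γ`. -/
def ConjInO (ι ι' : LambdaM ≃ₗ[ℤ] LambdaM) : Prop :=
  ∃ γ : LambdaM ≃ₗ[ℤ] LambdaM, IsIsometry γ ∧ ∀ x, ι' x = γ (ι (γ.symm x))

/-- A sublattice has signature (1,1): rank two, containing both an element of positive
square and an element of negative square. -/
def SigOneOne (K : Submodule ℤ LambdaM) : Prop :=
  Module.finrank ℤ K = 2 ∧ (∃ x ∈ K, 0 < LambdaB x x) ∧ (∃ x ∈ K, LambdaB x x < 0)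

/-- The orthogonal complement of a submodule of `Λ`. -/
def perpOf (K : Submodule ℤ LambdaM) : Submodule ℤ LambdaM where
  carrier := {x | ∀ s ∈ K, LambdaB x s = 0}
  add_mem' := by
    intro a b ha hb s hs
    simp [map_add, LinearMap.add_apply, ha s hs, hb s hs]
  zero_mem' := by
    intro s hs
    simp
  smul_mem' := by
    intro c a ha s hs
    simp only [_root_.map_smul, LinearMap.smul_apply, ha s hs, smul_zero]

/-- The bilinear form of the lattice `U ⊕ U(2) ⊕ E8² ⊕ ⟨−2⟩`. -/
def TargetB13 :
    ((Fin 2 → ℤ) × (Fin 2 → ℤ) × (Fin 8 → ℤ) × (Fin 8 → ℤ) × (Fin 1 → ℤ)) →ₗ[ℤ]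
      ((Fin 2 → ℤ) × (Fin 2 → ℤ) × (Fin 8 → ℤ) × (Fin 8 → ℤ) × (Fin 1 → ℤ)) →ₗ[ℤ] ℤ :=
  prodBilin (gramBilin UGram) <| prodBilin (gramBilin U2Gram) <|
    prodBilin (gramBilin E8Gram) <| prodBilin (gramBilin E8Gram) (gramBilin (rankOneGram (-2)))

/-- The orthogonal sum `U ⊕ b` of the hyperbolic plane and the form `b`. -/
abbrev hypSum {N : Type*} [AddCommGroup N] (b : N →ₗ[ℤ] N →ₗ[ℤ] ℤ) :
    ((Fin 2 → ℤ) × N) →ₗ[ℤ] ((Fin 2 → ℤ) × N) →ₗ[ℤ] ℤ :=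
  prodBilin (gramBilin UGram) b

/-- Some isometry of `B` fixes `z` and carries `x` to `y`. -/
def FixOrbit {M : Type*} [AddCommGroup M] (B : M →ₗ[ℤ] M →ₗ[ℤ] ℤ) (z x y : M) : Prop :=
  ∃ g : M ≃ₗ[ℤ] M, (∀ u v, B (g u) (g v) = B u v) ∧ g z = z ∧ g x = y

namespace FixOrbit

variable {M : Type*} [AddCommGroup M] {B : M →ₗ[ℤ] M →ₗ[ℤ] ℤ} {z x y w : M}

theorem refl : FixOrbit B z x x := ⟨LinearEquiv.refl ℤ M, by simp⟩

theorem trans (h : FixOrbit B z x y) (h' : FixOrbit B z y w) : FixOrbit B z x w := by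
  obtain ⟨g, hg, hz, rfl⟩ := h
  obtain ⟨g', hg', hz', rfl⟩ := h'
  exact ⟨g.trans g', by simp [hg, hg'], by simp [hz, hz'], by simp⟩

theorem apply_self (h : FixOrbit B z x y) : B y y = B x x := by
  obtain ⟨g, hg, -, rfl⟩ := h
  exact hg x x

theorem exists_apply_eq (h : FixOrbit B z x y) (u : M) : ∃ v, B y v = B x u := by
  obtain ⟨g, hg, -, rfl⟩ := h
  exact ⟨g u, hg x u⟩

theorem neg : FixOrbit B 0 x (-x) := ⟨LinearEquiv.neg ℤ, by simp⟩

end FixOrbit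

section Hyperbolic

variable {N : Type*} [AddCommGroup N] {b : N →ₗ[ℤ] N →ₗ[ℤ] ℤ}

theorem gramBilin_UGram (x y : Fin 2 → ℤ) :
    gramBilin UGram x y = x 0 * y 1 + x 1 * y 0 := by
  simp [gramBilin, UGram, Matrix.toLinearMap₂'_apply, Fin.sum_univ_two]

theorem prodBilin_apply {M : Type*} [AddCommGroup M] (c : M →ₗ[ℤ] M →ₗ[ℤ] ℤ) (x y : M × N) :
    prodBilin c b x y = c x.1 y.1 + b x.2 y.2 := rfl

theorem hypSum_apply (x y : (Fin 2 → ℤ) × N) :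
    hypSum b x y = x.1 0 * y.1 1 + x.1 1 * y.1 0 + b x.2 y.2 := by
  rw [prodBilin_apply, gramBilin_UGram]

/-- The Eichler transvection along the isotropic vector `(1, 0)` of `U` determined by `w`. -/
def eichlerTransvection (b : N →ₗ[ℤ] N →ₗ[ℤ] ℤ) (w : N) (k : ℤ) (hk : b w w = 2 * k) :
    ((Fin 2 → ℤ) × N) ≃ₗ[ℤ] ((Fin 2 → ℤ) × N) where
  toFun x := (![x.1 0 - b x.2 w - x.1 1 * k, x.1 1], x.2 + x.1 1 • w)
  invFun x := (![x.1 0 + b x.2 w - x.1 1 * k, x.1 1], x.2 - x.1 1 • w)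
  map_add' x y := by
    ext i
    · fin_cases i <;> simp
      ring
    · simp [add_smul]; abel
  map_smul' r x := by
    ext i
    · fin_cases i
      · simp; ring
      · simp
    · simp [mul_smul]
  left_inv x := by
    ext i
    · fin_cases i <;> simp [hk]; ring
    · simp
  right_inv x := by
    ext i
    · fin_cases i <;> simp [hk]; ring
    · simp

theorem fixOrbit_transvection (hs : ∀ x y, b x y = b y x) (w : N) (k : ℤ) (hk : b w w = 2 * k)
    (a : Fin 2 → ℤ) (m : N) :
    FixOrbit (hypSum b) (![1, 0], 0) (a, m)
      (![a 0 - b m w - a 1 * k, a 1], m + a 1 • w) := by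
  refine ⟨eichlerTransvection b w k hk, fun u v => ?_, by simp [eichlerTransvection], rfl⟩
  simp only [hypSum_apply, eichlerTransvection, LinearEquiv.coe_mk, LinearMap.coe_mk, AddHom.coe_mk]
  simp [hk, hs w]
  ring

theorem FixOrbit.of_fix {M : Type*} [AddCommGroup M] {B : M →ₗ[ℤ] M →ₗ[ℤ] ℤ} {z x y : M}
    (h : FixOrbit B z x y) : FixOrbit B 0 x y := by
  obtain ⟨g, hg, -, h⟩ := h
  exact ⟨g, hg, map_zero g, h⟩

theorem FixOrbit.prod {m m' : N} (h : FixOrbit b 0 m m') (z a : Fin 2 → ℤ) :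
    FixOrbit (hypSum b) (z, 0) (a, m) (a, m') := by
  obtain ⟨g, hg, -, rfl⟩ := h
  exact ⟨(LinearEquiv.refl ℤ _).prodCongr g, fun u v => by simp [prodBilin_apply, hg],
    by simp, by simp⟩

theorem fixOrbit_swap (a : Fin 2 → ℤ) (m : N) :
    FixOrbit (hypSum b) 0 (a, m) (![a 1, a 0], m) := by
  refine ⟨(LinearEquiv.funCongrLeft ℤ ℤ (Equiv.swap (0 : Fin 2) 1)).prodCongr (LinearEquiv.refl ℤ _),
    fun u v => ?_, map_zero _, ?_⟩
  · simp [hypSum_apply, LinearEquiv.funCongrLeft]; ring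
  · ext i
    · fin_cases i <;> simp [LinearEquiv.funCongrLeft]
    · simp

theorem fixOrbit_swap_planes (a c : Fin 2 → ℤ) (n : N) :
    FixOrbit (hypSum (hypSum b)) 0 (a, c, n) (c, a, n) := by
  refine ⟨⟨⟨⟨fun x => (x.2.1, x.1, x.2.2), fun _ _ => rfl⟩, fun _ _ => rfl⟩,
    fun x => (x.2.1, x.1, x.2.2), fun _ => rfl, fun _ => rfl⟩, fun u v => ?_, rfl, rfl⟩
  simp only [prodBilin_apply]
  exact add_left_comm _ _ _

theorem hypSum_symm (hs : ∀ x y, b x y = b y x) (x y : (Fin 2 → ℤ) × N) :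
    hypSum b x y = hypSum b y x := by
  rw [hypSum_apply, hypSum_apply, hs]; ring

theorem even_hypSum (he : ∀ x, Even (b x x)) (x : (Fin 2 → ℤ) × N) :
    Even (hypSum b x x) := by
  rw [hypSum_apply, mul_comm (x.1 1)]
  exact (Even.add_self _).add (he _)

theorem exists_fixOrbit_not_dvd (hs : ∀ x y, b x y = b y x) (he : ∀ x, Even (b x x)) {d : ℤ}
    {x : (Fin 2 → ℤ) × (Fin 2 → ℤ) × N} (hx : ∃ y, ¬ d ∣ hypSum (hypSum b) x y) :
    ∃ x', FixOrbit (hypSum (hypSum b)) 0 x x' ∧ ¬ d ∣ x'.1 1 := by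
  obtain ⟨a, c, n⟩ := x
  by_cases ha1 : d ∣ a 1; swap
  · exact ⟨_, .refl, ha1⟩
  by_cases ha0 : d ∣ a 0; swap
  · exact ⟨_, fixOrbit_swap _ _, by simpa⟩
  by_cases hc1 : d ∣ c 1; swap
  · exact ⟨_, fixOrbit_swap_planes _ _ _, hc1⟩
  by_cases hc0 : d ∣ c 0; swap
  · exact ⟨_, (fixOrbit_swap_planes _ _ _).trans (fixOrbit_swap _ _), by simpa⟩
  obtain ⟨y, hy⟩ := hx
  have hn : ¬ d ∣ b n y.2.2 := by
    contrapose! hy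
    simp only [hypSum_apply]
    exact dvd_add (dvd_add (ha0.mul_right _) (ha1.mul_right _))
      (dvd_add (dvd_add (hc0.mul_right _) (hc1.mul_right _)) hy)
  obtain ⟨k, hk⟩ := even_iff_exists_two_mul.1 (he y.2.2)
  refine ⟨_, (fixOrbit_transvection (hypSum_symm hs) (0, y.2.2) k
    (by simpa [prodBilin_apply] using hk) a (c, n)).of_fix.trans (fixOrbit_swap _ _), ?_⟩
  simp only [prodBilin_apply, map_zero, zero_add, Matrix.cons_val_zero, Matrix.cons_val_one]
  rwa [dvd_sub_left (ha1.mul_right _), dvd_sub_right ha0]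

/-- The transitivity of the isometry group of `U ⊕ U ⊕ N` on isotropic vectors of divisibility
one, for an even lattice `N`. -/
theorem fixOrbit_of_isotropic (hs : ∀ x y, b x y = b y x) (he : ∀ x, Even (b x x))
    {x : (Fin 2 → ℤ) × (Fin 2 → ℤ) × N} (hx : ∃ y, hypSum (hypSum b) x y = 1)
    (hx0 : hypSum (hypSum b) x x = 0) :
    FixOrbit (hypSum (hypSum b)) 0 x (![1, 0], 0) := by
  classical
  have hne : ∃ n : ℕ, ∃ x', FixOrbit (hypSum (hypSum b)) 0 x x' ∧ x'.1 1 ≠ 0 ∧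
      (x'.1 1).natAbs = n := by
    obtain ⟨y, hy⟩ := hx
    obtain ⟨x', h, h'⟩ := exists_fixOrbit_not_dvd hs he (d := 0) (x := x) ⟨y, by simp [hy]⟩
    exact ⟨_, x', h, by simpa using h', rfl⟩
  obtain ⟨⟨a, c, n⟩, hax, had, ha⟩ := Nat.find_spec hne
  have hmin : ∀ x', FixOrbit (hypSum (hypSum b)) 0 x x' →
      (x'.1 1).natAbs < (a 1).natAbs → x'.1 1 = 0 := by
    intro x' h hlt
    by_contra h0
    exact Nat.find_min hne (ha ▸ hlt) ⟨x', h, h0, rfl⟩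
  change a 1 ≠ 0 at had
  have hs' := hypSum_symm hs
  have key : ∀ a' c' n', FixOrbit (hypSum (hypSum b)) 0 x (a', c', n') → a' 1 = a 1 →
      a 1 ∣ c' 1 := by
    intro a' c' n' h h1
    have h2 := hmin _ ((h.trans (fixOrbit_transvection hs' (![0, -(c' 1 / a 1)], 0) 0
      (by simp [hypSum_apply]) a' (c', n')).of_fix).trans (fixOrbit_swap_planes _ _ _)) (by
        simp only [h1, Prod.smul_mk, Pi.add_apply, Pi.smul_apply, cons_val_one, cons_val_fin_one,
          smul_eq_mul]
        rw [mul_neg, ← sub_eq_add_neg, ← Int.emod_def]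
        zify
        rw [abs_of_nonneg (Int.emod_nonneg _ had)]
        exact Int.emod_lt_abs _ had)
    simp only [h1, Prod.smul_mk, Pi.add_apply, Pi.smul_apply, cons_val_one, cons_val_fin_one,
          smul_eq_mul] at h2
    exact ⟨c' 1 / a 1, by linarith⟩
  have key0 : ∀ a' c' n', FixOrbit (hypSum (hypSum b)) 0 x (a', c', n') → a' 1 = a 1 →
      a 1 ∣ c' 0 := by
    intro a' c' n' h h1
    simpa using key _ _ _ (h.trans ((fixOrbit_swap c' n').prod 0 a')) h1
  obtain ⟨s, hs1⟩ := key _ _ _ hax rfl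
  obtain ⟨t, ht⟩ := key0 _ _ _ hax rfl
  obtain ⟨a', ha', hc'⟩ :
      ∃ a' : Fin 2 → ℤ, a' 1 = a 1 ∧
      FixOrbit (hypSum (hypSum b)) 0 x (a', 0, n) := by
    have h := hax.trans (fixOrbit_transvection hs' (![-t, -s], 0) (t * s)
      (by simp [hypSum_apply]; ring) a (c, n)).of_fix
    have hc : (c, n) + a 1 • ((![-t, -s], 0) : (Fin 2 → ℤ) × N) = (0, n) := by
      refine Prod.ext ?_ (by simp)
      ext i
      fin_cases i
      · change c 0 + a 1 * -t = 0
        rw [ht]; ring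
      · change c 1 + a 1 * -s = 0
        rw [hs1]; ring
    rw [hc] at h
    exact ⟨_, by simp, h⟩
  have hdvd : ∀ w, a 1 ∣ hypSum b (a', n) w := by
    intro w
    obtain ⟨k, hk⟩ := even_iff_exists_two_mul.1 (even_hypSum he w)
    have h := key0 _ _ _ ((hc'.trans (fixOrbit_swap_planes _ _ _)).trans
      ((fixOrbit_transvection hs' w k hk 0 (a', n)).of_fix.trans
        (fixOrbit_swap_planes _ _ _))) (by simp [ha'])
    simpa using h
  have hunit : a 1 ∣ 1 := by
    obtain ⟨y, hy⟩ := hx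
    obtain ⟨v, hv⟩ := hc'.exists_apply_eq y
    rw [← hy, ← hv]
    have := hdvd (v.1, v.2.2)
    simpa [hypSum_apply] using this
  obtain ⟨⟨p, r⟩, hr, hp⟩ : ∃ x', FixOrbit (hypSum (hypSum b)) 0 x x' ∧ x'.1 1 = 1 := by
    rcases Int.isUnit_iff.1 (isUnit_of_dvd_one hunit) with h | h
    · exact ⟨_, hax, h⟩
    · exact ⟨_, hax.trans .neg, by simp [h]⟩
  change p 1 = 1 at hp
  obtain ⟨k, hk⟩ := even_iff_exists_two_mul.1 (even_hypSum he (-r))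
  have hfin := hr.trans (fixOrbit_transvection hs' (-r) k hk p r).of_fix
  have h0 := hfin.apply_self
  simp only [hp, one_smul, add_neg_cancel] at hfin h0
  generalize p 0 - hypSum b r (-r) - 1 * k = q at hfin h0
  rw [hx0, hypSum_apply] at h0
  obtain rfl : q = 0 := by simp at h0; linarith
  simpa using hfin.trans (fixOrbit_swap _ _)

theorem fixOrbit_of_apply_eq_two (hs : ∀ x y, b x y = b y x) (he : ∀ x, Even (b x x))
    {x : (Fin 2 → ℤ) × (Fin 2 → ℤ) × (Fin 2 → ℤ) × N} (hx1 : x.1 1 = 2)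
    (hx0 : hypSum (hypSum (hypSum b)) x x = 0)
    (hodd : ∃ y, ¬ 2 ∣ hypSum (hypSum b) x.2 y) :
    FixOrbit (hypSum (hypSum (hypSum b))) (![1, 0], 0) x (![0, 2], ![0, 1], 0) := by
  obtain ⟨a, m⟩ := x
  dsimp only at hx1 hodd
  have hs' := hypSum_symm hs
  have hs'' := hypSum_symm hs'
  obtain ⟨⟨s, r⟩, h, hs1⟩ := exists_fixOrbit_not_dvd hs he hodd
  obtain ⟨t, ht⟩ := Int.not_even_iff_odd.1 (mt even_iff_two_dvd.1 hs1)
  obtain ⟨p, q, h1⟩ : ∃ p q : ℤ,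
      FixOrbit (hypSum (hypSum (hypSum b))) (![1, 0], 0) (a, m) (![p, 2], ![q, 1], r) := by
    have h1 := (h.prod ![1, 0] a).trans (fixOrbit_transvection hs'' (![0, -t], 0) 0
      (by simp [hypSum_apply]) a (s, r))
    have hsr : (s, r) + a 1 • ((![0, -t], 0) : (Fin 2 → ℤ) × (Fin 2 → ℤ) × N) =
        (![s 0, 1], r) := by
      refine Prod.ext ?_ (by simp)
      dsimp only at ht
      ext i
      fin_cases i
      · change s 0 + a 1 * 0 = s 0
        ring
      · change s 1 + a 1 * -t = 1
        rw [hx1, ht]; ring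
    rw [hsr, hx1] at h1
    exact ⟨_, _, h1⟩
  obtain ⟨k, hk⟩ := even_iff_exists_two_mul.1 (even_hypSum he (-r))
  obtain ⟨q', h2⟩ : ∃ q' : ℤ,
      FixOrbit (hypSum (hypSum (hypSum b))) (![1, 0], 0) (a, m) (![p, 2], ![q', 1], 0) :=
    ⟨_, by simpa using
      h1.trans ((fixOrbit_transvection hs' (-r) k hk _ _).of_fix.prod ![1, 0] _)⟩
  have h0 := h2.apply_self
  rw [hx0] at h0
  obtain rfl : q' = -2 * p := by simp [hypSum_apply] at h0; linarith
  obtain ⟨p', h3⟩ : ∃ p' : ℤ,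
      FixOrbit (hypSum (hypSum (hypSum b))) (![1, 0], 0) (a, m) (![p', 2], ![0, 1], 0) :=
    ⟨_, by simpa using
      h2.trans (fixOrbit_transvection hs'' (![p, 0], 0) 0 (by simp [hypSum_apply]) _ _)⟩
  have h0' := h3.apply_self
  rw [hx0] at h0'
  obtain rfl : p' = 0 := by simp [hypSum_apply] at h0'; linarith
  exact h3

end Hyperbolic

section Gram

variable {n : ℕ} {G : Matrix (Fin n) (Fin n) ℤ}

theorem gramBilin_apply (x y : Fin n → ℤ) : gramBilin G x y = x ⬝ᵥ G *ᵥ y :=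
  Matrix.toLinearMap₂'_apply' G x y

theorem gramBilin_symm (hG : G.IsSymm) (x y : Fin n → ℤ) :
    gramBilin G x y = gramBilin G y x := by
  rw [gramBilin_apply, gramBilin_apply, dotProduct_mulVec, dotProduct_comm, ← mulVec_transpose,
    hG.eq]

theorem exists_eq_two_smul_of_gramBilin (hG : IsUnit G.det) {x : Fin n → ℤ}
    (hx : ∀ y, 2 ∣ gramBilin G x y) : ∃ x', x = (2 : ℤ) • x' := by
  have h : ∀ i, 2 ∣ x i := fun i => by
    have h := hx (G⁻¹ *ᵥ Pi.single i 1)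
    rw [gramBilin_apply, mulVec_mulVec, mul_nonsing_inv G hG, one_mulVec] at h
    simpa using h
  choose x' hx' using h
  exact ⟨x', funext hx'⟩

theorem isSymm_E8Gram : E8Gram.IsSymm := by
  simpa [E8Gram] using CartanMatrix.E₈_isSymm

theorem isUnit_det_E8Gram : IsUnit E8Gram.det := by
  simp [E8Gram, Matrix.det_neg, CartanMatrix.E₈_det]

theorem isUnit_det_UGram : IsUnit UGram.det := by
  simp [UGram]

theorem even_gramBilin_E8Gram (x : Fin 8 → ℤ) : Even (gramBilin E8Gram x x) := by
  rw [even_iff_exists_two_mul]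
  refine ⟨x 0 * x 2 + x 1 * x 3 + x 2 * x 3 + x 3 * x 4 + x 4 * x 5 + x 5 * x 6 + x 6 * x 7 -
    (x 0 ^ 2 + x 1 ^ 2 + x 2 ^ 2 + x 3 ^ 2 + x 4 ^ 2 + x 5 ^ 2 + x 6 ^ 2 + x 7 ^ 2), ?_⟩
  simp [gramBilin_apply, E8Gram, CartanMatrix.E₈, dotProduct, mulVec, Fin.sum_univ_succ]
  ring

theorem gramBilin_rankOneGram (k : ℤ) (x y : Fin 1 → ℤ) :
    gramBilin (rankOneGram k) x y = k * (x 0 * y 0) := by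
  simp [gramBilin_apply, rankOneGram, dotProduct, mulVec]
  ring

theorem gramBilin_U2Gram (x y : Fin 2 → ℤ) :
    gramBilin U2Gram x y = 2 * (x 0 * y 1 + x 1 * y 0) := by
  simp [gramBilin_apply, U2Gram, dotProduct, mulVec, Fin.sum_univ_two]
  ring

end Gram

/-- The form of `E8² ⊕ ⟨-2⟩`. -/
abbrev definiteB :
    ((Fin 8 → ℤ) × (Fin 8 → ℤ) × (Fin 1 → ℤ)) →ₗ[ℤ]
      ((Fin 8 → ℤ) × (Fin 8 → ℤ) × (Fin 1 → ℤ)) →ₗ[ℤ] ℤ :=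
  prodBilin (gramBilin E8Gram) <| prodBilin (gramBilin E8Gram) (gramBilin (rankOneGram (-2)))

theorem definiteB_symm (x y) : definiteB x y = definiteB y x := by
  simp only [prodBilin_apply, gramBilin_rankOneGram]
  rw [gramBilin_symm isSymm_E8Gram x.1, gramBilin_symm isSymm_E8Gram x.2.1, mul_comm (x.2.2 0)]

theorem even_definiteB (x) : Even (definiteB x x) := by
  simp only [prodBilin_apply, gramBilin_rankOneGram]
  exact (even_gramBilin_E8Gram _).add ((even_gramBilin_E8Gram _).add
    ((by decide : Even (-2 : ℤ)).mul_right _))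

theorem LambdaB_eq : LambdaB = hypSum (hypSum (hypSum definiteB)) := rfl

theorem exists_eq_two_smul_of_LambdaB {v : LambdaM} (hv : ∀ x, 2 ∣ LambdaB v x)
    (hvv : 4 ∣ LambdaB v v) : ∃ v', v = (2 : ℤ) • v' := by
  obtain ⟨a, b, c, x, y, z⟩ := v
  obtain ⟨a, rfl⟩ := exists_eq_two_smul_of_gramBilin isUnit_det_UGram (x := a) fun u => by
    simpa [LambdaB, prodBilin_apply] using hv (u, 0, 0, 0, 0, 0)
  obtain ⟨b, rfl⟩ := exists_eq_two_smul_of_gramBilin isUnit_det_UGram (x := b) fun u => by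
    simpa [LambdaB, prodBilin_apply] using hv (0, u, 0, 0, 0, 0)
  obtain ⟨c, rfl⟩ := exists_eq_two_smul_of_gramBilin isUnit_det_UGram (x := c) fun u => by
    simpa [LambdaB, prodBilin_apply] using hv (0, 0, u, 0, 0, 0)
  obtain ⟨x, rfl⟩ := exists_eq_two_smul_of_gramBilin isUnit_det_E8Gram (x := x) fun u => by
    simpa [LambdaB, prodBilin_apply] using hv (0, 0, 0, u, 0, 0)
  obtain ⟨y, rfl⟩ := exists_eq_two_smul_of_gramBilin isUnit_det_E8Gram (x := y) fun u => by
    simpa [LambdaB, prodBilin_apply] using hv (0, 0, 0, 0, u, 0)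
  have hz : Even (z 0 * z 0) := by
    simp only [LambdaB, prodBilin_apply, gramBilin_rankOneGram, _root_.map_smul,
      LinearMap.smul_apply, smul_eq_mul] at hvv
    rw [even_iff_two_dvd]
    omega
  obtain ⟨k, hk⟩ := even_iff_exists_two_mul.1 ((Int.even_mul.1 hz).elim id id)
  refine ⟨(a, b, c, x, y, ![k]), ?_⟩
  simp only [Prod.smul_mk, Prod.mk.injEq, true_and]
  ext i
  fin_cases i
  simpa using hk

theorem TargetB13_apply {u v : LambdaM} (hu : u.1 1 = 0) (hu' : 2 * u.1 0 + u.2.1 0 = 0)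
    (hv : v.1 1 = 0) (hv' : 2 * v.1 0 + v.2.1 0 = 0) :
    TargetB13 (u.2.2.1, ![-u.1 0, u.2.1 1], u.2.2.2) (v.2.2.1, ![-v.1 0, v.2.1 1], v.2.2.2) =
      LambdaB u v := by
  obtain ⟨a, b, c, u⟩ := u
  obtain ⟨a', b', c', v⟩ := v
  dsimp only at hu hu' hv hv' ⊢
  change gramBilin UGram c c' + (gramBilin U2Gram ![-a 0, b 1] ![-a' 0, b' 1] + definiteB u v) =
    gramBilin UGram a a' + (gramBilin UGram b b' + (gramBilin UGram c c' + definiteB u v))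
  rw [gramBilin_U2Gram, gramBilin_UGram a, gramBilin_UGram b, hu, hv,
    eq_neg_of_add_eq_zero_right hu', eq_neg_of_add_eq_zero_right hv']
  simp only [cons_val_zero, cons_val_one, cons_val_fin_one]
  ring

theorem isometricTo_of_mem_perpOf_iff {K : Submodule ℤ LambdaM} (g : LambdaM ≃ₗ[ℤ] LambdaM)
    (hg : ∀ x y, LambdaB (g x) (g y) = LambdaB x y)
    (hK : ∀ x, x ∈ perpOf K ↔ (g x).1 1 = 0 ∧ 2 * (g x).1 0 + (g x).2.1 0 = 0) :
    IsometricTo (perpOf K) TargetB13 := by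
  obtain ⟨φ, hφ⟩ : ∃ φ : perpOf K ≃ₗ[ℤ]
      ((Fin 2 → ℤ) × (Fin 2 → ℤ) × (Fin 8 → ℤ) × (Fin 8 → ℤ) × (Fin 1 → ℤ)),
      ∀ x, φ x = ((g x).2.2.1, ![-(g x).1 0, (g x).2.1 1], (g x).2.2.2) := by
    refine ⟨{
      toFun x := ((g x).2.2.1, ![-(g x).1 0, (g x).2.1 1], (g x).2.2.2)
      invFun y := ⟨g.symm (![-y.2.1 0, 0], ![2 * y.2.1 0, y.2.1 1], y.1, y.2.2), by simp [hK]⟩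
      map_add' x y := ?_
      map_smul' r x := ?_
      left_inv x := ?_
      right_inv y := ?_ }, fun x => rfl⟩
    · refine Prod.ext (by simp) (Prod.ext ?_ (by simp))
      ext i
      fin_cases i
      · simp only [Submodule.coe_add, map_add]
        exact neg_add _ _
      · simp only [Submodule.coe_add, map_add]
        rfl
    · refine Prod.ext (by simp only [Submodule.coe_smul, _root_.map_smul]; rfl)
        (Prod.ext ?_ (by simp only [Submodule.coe_smul, _root_.map_smul]; rfl))
      ext i
      fin_cases i
      · simp only [Submodule.coe_smul, _root_.map_smul]
        exact (mul_neg _ _).symm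
      · simp only [Submodule.coe_smul, _root_.map_smul]
        rfl
    · obtain ⟨x, hx⟩ := x
      obtain ⟨h1, h2⟩ := (hK x).1 hx
      apply Subtype.ext
      apply g.injective
      simp only [LinearEquiv.apply_symm_apply]
      refine Prod.ext ?_ (Prod.ext ?_ rfl)
      · ext i; fin_cases i <;> simp [h1]
      · ext i
        fin_cases i
        · simp; linarith
        · simp
    · refine Prod.ext (by simp) (Prod.ext ?_ (by simp))
      ext i; fin_cases i <;> simp
  refine ⟨φ, fun x y => ?_⟩
  obtain ⟨h1, h2⟩ := (hK x).1 x.2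
  obtain ⟨h3, h4⟩ := (hK y).1 y.2
  rw [hφ, hφ, ← hg]
  exact TargetB13_apply h1 h2 h3 h4

/-- If `ι ∈ O(Λ)` is an involution of `Λ = U³ ⊕ E8² ⊕ ⟨−2⟩` whose invariant sublattice is
isometric to `U(2)`, then the orthogonal complement `(Λ^ι)^⊥` in `Λ` is isometric to
`U ⊕ U(2) ⊕ E8² ⊕ ⟨−2⟩`. -/
theorem perp_of_invariant_U2
    (ι : LambdaM ≃ₗ[ℤ] LambdaM) (hisom : IsIsometry ι) (hinvol : ∀ x, ι (ι x) = x)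
    (hU2 : IsometricTo (invLattice ι) (gramBilin U2Gram)) :
    IsometricTo (perpOf (invLattice ι)) TargetB13 := by
  obtain ⟨e, he⟩ := hU2
  have he' : ∀ u v, LambdaB (e.symm u : LambdaM) (e.symm v) = gramBilin U2Gram u v := by
    intro u v
    rw [← he, e.apply_symm_apply, e.apply_symm_apply]
  have hodd : ∀ w : Fin 2 → ℤ, ¬ 2 ∣ w 0 ∨ ¬ 2 ∣ w 1 →
      ∃ y, ¬ 2 ∣ LambdaB (e.symm w : LambdaM) y := by
    intro w hw
    by_contra! h
    obtain ⟨v, hv⟩ := exists_eq_two_smul_of_LambdaB h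
      ⟨w 0 * w 1, by rw [he', gramBilin_U2Gram]; ring⟩
    have hvK : v ∈ invLattice ι := by
      have h1 : ι (e.symm w : LambdaM) = (e.symm w : LambdaM) := (e.symm w).2
      rw [hv, _root_.map_smul] at h1
      exact smul_right_injective LambdaM (two_ne_zero (α := ℤ)) h1
    have h2 : w = (2 : ℤ) • e ⟨v, hvK⟩ := by
      rw [← _root_.map_smul, ← LinearEquiv.symm_apply_eq]
      exact Subtype.ext hv
    rw [h2] at hw
    simp at hw
  obtain ⟨y, hy⟩ := hodd ![1, 0] (by simp)
  obtain ⟨t, ht⟩ := Int.not_even_iff_odd.1 (mt even_iff_two_dvd.1 hy)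
  obtain ⟨g₁, hg₁, -, hge⟩ := fixOrbit_of_isotropic (hypSum_symm definiteB_symm)
    (even_hypSum even_definiteB) (x := (e.symm ![1, 0] : LambdaM))
    ⟨y - t • (e.symm ![0, 1] : LambdaM), by
      rw [← LambdaB_eq, map_sub, _root_.map_smul, he', ht, gramBilin_U2Gram]; simp; ring⟩
    (by rw [← LambdaB_eq, he', gramBilin_U2Gram]; simp)
  rw [← LambdaB_eq] at hg₁
  have hf1 : (g₁ (e.symm ![0, 1])).1 1 = 2 := by
    have h := hg₁ (e.symm ![1, 0]) (e.symm ![0, 1])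
    rw [he', hge, gramBilin_U2Gram, LambdaB_eq, hypSum_apply] at h
    simpa using h
  obtain ⟨g₂, hg₂, hge₂, hgf₂⟩ := fixOrbit_of_apply_eq_two definiteB_symm even_definiteB hf1
    (by rw [← LambdaB_eq, hg₁, he', gramBilin_U2Gram]; simp) (by
      obtain ⟨y, hy⟩ := hodd ![-(g₁ (e.symm ![0, 1])).1 0, 1] (by simp)
      refine ⟨(g₁ y).2, fun h => hy ?_⟩
      have hw : (e.symm ![-(g₁ (e.symm ![0, 1])).1 0, 1] : LambdaM) =
          (e.symm ![0, 1] : LambdaM) - (g₁ (e.symm ![0, 1])).1 0 • (e.symm ![1, 0] : LambdaM) := by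
        rw [← Submodule.coe_smul, ← Submodule.coe_sub, ← _root_.map_smul, ← map_sub]
        simp
      rw [← hg₁, hw, map_sub, _root_.map_smul, hge, LambdaB_eq, hypSum_apply]
      simpa [hf1] using h)
  rw [← LambdaB_eq] at hg₂
  refine isometricTo_of_mem_perpOf_iff (g₁.trans g₂) (by simp [hg₁, hg₂]) fun x => ?_
  have hxe : LambdaB x (e.symm ![1, 0]) = (g₂ (g₁ x)).1 1 := by
    rw [← hg₁, ← hg₂, hge, hge₂, LambdaB_eq, hypSum_apply]
    simp
  have hxf : LambdaB x (e.symm ![0, 1]) = 2 * (g₂ (g₁ x)).1 0 + (g₂ (g₁ x)).2.1 0 := by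
    rw [← hg₁, ← hg₂, hgf₂, LambdaB_eq, hypSum_apply, hypSum_apply]
    simp [mul_comm]
  rw [LinearEquiv.trans_apply, ← hxe, ← hxf]
  refine ⟨fun h => ⟨h _ (e.symm _).2, h _ (e.symm _).2⟩, fun ⟨h1, h2⟩ s hs => ?_⟩
  have hw : s = (e ⟨s, hs⟩) 0 • (e.symm ![1, 0] : LambdaM) +
      (e ⟨s, hs⟩) 1 • (e.symm ![0, 1] : LambdaM) := by
    rw [← Submodule.coe_smul, ← Submodule.coe_smul, ← Submodule.coe_add, ← _root_.map_smul,
      ← _root_.map_smul, ← map_add]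
    have : (e ⟨s, hs⟩) 0 • ![1, 0] + (e ⟨s, hs⟩) 1 • ![0, 1] = e ⟨s, hs⟩ := by
      ext i; fin_cases i <;> simp
    rw [this, e.symm_apply_apply]
  rw [hw, map_add, _root_.map_smul, _root_.map_smul, h1, h2]
  simp
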